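/- arXiv:1712.01079 — 2 statements merged into one kernel-verified Lean document; each statement's English description precedes it below -/
import Mathlib

section
/- Let G be a finitely generated group with infinite center Z(G), and let H be an infinite strongly quasiconvex (Morse) subgroup of G. Then H has finite index in G. -/
open Set

namespace Paper

/-- Word metric distance with respect to a (symmetrized) generating set `S`. -/
noncomputable def wordDist {G : Type*} [Group G] (S : Set G) (g h : G) : ℕ :=
  sInf {n | ∃ w : List G, w.length = n ∧ (∀ x ∈ w, x ∈ S ∨ x⁻¹ ∈ S) ∧ g⁻¹ * h = w.prod}

/-- A discrete `(K, C)`-quasi-geodesic in the word metric. -/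
def IsQuasiGeodesic {G : Type*} [Group G] (S : Set G) (K C : ℝ) {n : ℕ}
    (q : Fin (n + 1) → G) : Prop :=
  ∀ i j : Fin (n + 1),
    (wordDist S (q i) (q j) : ℝ) ≤ K * |((i : ℕ) : ℝ) - ((j : ℕ) : ℝ)| + C ∧
      |((i : ℕ) : ℝ) - ((j : ℕ) : ℝ)| / K - C ≤ (wordDist S (q i) (q j) : ℝ)

/-- A subset `H` is strongly quasiconvex (Morse) with respect to the word metric of `S`:
every quasi-geodesic with endpoints in `H` stays uniformly close to `H`. -/
def StronglyQuasiconvex {G : Type*} [Group G] (S : Set G) (H : Set G) : Prop :=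
  ∀ K C : ℝ, 1 ≤ K → 0 ≤ C → ∃ M : ℝ, ∀ (n : ℕ) (q : Fin (n + 1) → G),
    q 0 ∈ H → q (Fin.last n) ∈ H → IsQuasiGeodesic S K C q →
      ∀ i, ∃ h ∈ H, (wordDist S (q i) h : ℝ) ≤ M

/-- The subgroup `H` (with generating data `T`) is undistorted in `G` (with generating data `S`):
the inclusion is a quasi-isometric embedding for the word metrics. -/
def Undistorted {G : Type*} [Group G] (S : Set G) (H : Subgroup G) (T : Set H) : Prop :=
  ∃ K C : ℝ, 1 ≤ K ∧ 0 ≤ C ∧ ∀ a b : H,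
    (wordDist T a b : ℝ) ≤ K * (wordDist S (a : G) (b : G)) + C ∧
      (wordDist S (a : G) (b : G) : ℝ) ≤ K * (wordDist T a b) + C

/-- Quasi-isometry between two groups with chosen generating sets. -/
def QuasiIsometric (G : Type*) [Group G] (S : Set G) (H : Type*) [Group H] (T : Set H) :
    Prop :=
  ∃ (φ : G → H) (K C : ℝ), 1 ≤ K ∧ 0 ≤ C ∧
    (∀ a b : G,
      (wordDist T (φ a) (φ b) : ℝ) ≤ K * (wordDist S a b) + C ∧
        (wordDist S a b : ℝ) ≤ K * (wordDist T (φ a) (φ b)) + C) ∧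
    ∀ h : H, ∃ g : G, (wordDist T (φ g) h : ℝ) ≤ C

/-- A group action on a graph by graph automorphisms. -/
def ActsOnGraph (G : Type*) [Group G] {V : Type*} [MulAction G V] (Γ : SimpleGraph V) :
    Prop :=
  ∀ (g : G) (v w : V), Γ.Adj v w → Γ.Adj (g • v) (g • w)

/-- Relators of the right-angled Coxeter group of a graph. -/
def racgRels {V : Type*} (Γ : SimpleGraph V) : Set (FreeGroup V) :=
  {r | ∃ v : V, r = FreeGroup.of v * FreeGroup.of v} ∪
    {r | ∃ v w : V, Γ.Adj v w ∧ r = (FreeGroup.of v * FreeGroup.of w) ^ 2}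

/-- The right-angled Coxeter group of a simplicial graph. -/
abbrev RACG {V : Type*} (Γ : SimpleGraph V) : Type _ := PresentedGroup (racgRels Γ)

/-- The standard (vertex) generating set of a RACG. -/
def racgGen {V : Type*} (Γ : SimpleGraph V) : Set (RACG Γ) :=
  Set.range fun v : V => (PresentedGroup.of v : RACG Γ)

/-- The special subgroup of a RACG generated by a set of vertices. -/
def specialSubgroup {V : Type*} (Γ : SimpleGraph V) (J : Set V) : Subgroup (RACG Γ) :=
  Subgroup.closure ((fun v : V => (PresentedGroup.of v : RACG Γ)) '' J)

/-- Relators of the right-angled Artin group of a graph. -/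
def raagRels {V : Type*} (Γ : SimpleGraph V) : Set (FreeGroup V) :=
  {r | ∃ v w : V, Γ.Adj v w ∧
    r = FreeGroup.of v * FreeGroup.of w * (FreeGroup.of v)⁻¹ * (FreeGroup.of w)⁻¹}

/-- The right-angled Artin group of a simplicial graph. -/
abbrev RAAG {V : Type*} (Γ : SimpleGraph V) : Type _ := PresentedGroup (raagRels Γ)

/-- The standard (vertex) generating set of a RAAG. -/
def raagGen {V : Type*} (Γ : SimpleGraph V) : Set (RAAG Γ) :=
  Set.range fun v : V => (PresentedGroup.of v : RAAG Γ)

/-- The coned-off Cayley graph of `G` with respect to the generating set `S` and the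
peripheral collection `P`. -/
def conedOffCayley (G : Type*) [Group G] (S : Set G) {ι : Type*} (P : ι → Subgroup G) :
    SimpleGraph (G ⊕ Σ i : ι, G ⧸ P i) :=
  SimpleGraph.fromRel fun x y =>
    match x, y with
    | Sum.inl g, Sum.inl h => g⁻¹ * h ∈ S
    | Sum.inl g, Sum.inr ⟨i, c⟩ => (QuotientGroup.mk g : G ⧸ P i) = c
    | _, _ => False

/-- A connected graph is hyperbolic if its path metric satisfies the four-point condition. -/
def IsHyperbolicGraph {α : Type*} (Γ : SimpleGraph α) : Prop :=
  Γ.Connected ∧ ∃ δ : ℝ, 0 ≤ δ ∧ ∀ x y z w : α,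
    (Γ.dist x y : ℝ) + (Γ.dist z w : ℝ) ≤
      max ((Γ.dist x z : ℝ) + (Γ.dist y w : ℝ)) ((Γ.dist x w : ℝ) + (Γ.dist y z : ℝ)) + δ

/-- A graph is fine if each edge lies in only finitely many circuits of each bounded length. -/
def IsFineGraph {α : Type*} (Γ : SimpleGraph α) : Prop :=
  ∀ (n : ℕ) (v w : α), Γ.Adj v w →
    {p : Γ.Walk v v | p.IsCircuit ∧ p.length ≤ n ∧ s(v, w) ∈ p.edges}.Finite

/-- `G` is hyperbolic relative to the finite collection of subgroups `P`. -/
def RelativelyHyperbolic (G : Type*) [Group G] {ι : Type*} (P : ι → Subgroup G) : Prop :=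
  Finite ι ∧ ∃ S : Finset G, Subgroup.closure (S : Set G) = ⊤ ∧
    IsHyperbolicGraph (conedOffCayley G (S : Set G) P) ∧
    IsFineGraph (conedOffCayley G (S : Set G) P)

/-- There is a path from `x` to `y` of length at most `L` in the Cayley graph of `(G,S)`
avoiding the ball of radius `r` about the identity. -/
def PathAvoiding {G : Type*} [Group G] (S : Set G) (r : ℕ) (x y : G) (L : ℕ) : Prop :=
  ∃ (m : ℕ) (p : Fin (m + 1) → G), p 0 = x ∧ p (Fin.last m) = y ∧ m ≤ L ∧
    (∀ i : Fin m, wordDist S (p i.castSucc) (p i.succ) ≤ 1) ∧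
    ∀ i, r ≤ wordDist S 1 (p i)

/-- The divergence of `(G,S)` is bounded above by (a linear function of) `f`. -/
def DivergenceUpperBound (G : Type*) [Group G] (S : Set G) (f : ℕ → ℕ) : Prop :=
  ∃ A B : ℕ, 0 < A ∧ ∀ (n : ℕ) (x y : G), wordDist S 1 x = n → wordDist S 1 y = n →
    PathAvoiding S (n / 2) x y (A * f n + B)

/-- The divergence of `(G,S)` is bounded below by (a linear function of) `f`. -/
def DivergenceLowerBound (G : Type*) [Group G] (S : Set G) (f : ℕ → ℕ) : Prop :=
  ∃ A B : ℕ, 0 < A ∧ ∀ N : ℕ, ∃ n, N ≤ n ∧ ∃ x y : G,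
    wordDist S 1 x = n ∧ wordDist S 1 y = n ∧
    ∀ L : ℕ, PathAvoiding S (n / 2) x y L → f n ≤ A * L + B

def HasLinearDivergence (G : Type*) [Group G] (S : Set G) : Prop :=
  DivergenceUpperBound G S (fun n => n) ∧ DivergenceLowerBound G S (fun n => n)

def HasQuadraticDivergence (G : Type*) [Group G] (S : Set G) : Prop :=
  DivergenceUpperBound G S (fun n => n ^ 2) ∧ DivergenceLowerBound G S (fun n => n ^ 2)

def HasExponentialDivergence (G : Type*) [Group G] (S : Set G) : Prop :=
  (∃ b : ℕ, 2 ≤ b ∧ DivergenceUpperBound G S (fun n => b ^ n)) ∧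
    DivergenceLowerBound G S (fun n => 2 ^ n)

/-- `c` parametrizes an induced 4-cycle of `Γ`. -/
def IsInducedFourCycle {V : Type*} (Γ : SimpleGraph V) (c : Fin 4 → V) : Prop :=
  Function.Injective c ∧ ∀ i j : Fin 4, Γ.Adj (c i) (c j) ↔ (j = i + 1 ∨ i = j + 1)

/-- `s` is the vertex set of an induced 4-cycle of `Γ`. -/
def IsFourCycleSet {V : Type*} (Γ : SimpleGraph V) (s : Set V) : Prop :=
  ∃ c : Fin 4 → V, IsInducedFourCycle Γ c ∧ Set.range c = s

/-- The four-cycle graph `Γ⁴`: vertices are the induced 4-cycles of `Γ`, adjacent when the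
corresponding 4-cycles share a pair of non-adjacent vertices. -/
def fourCycleGraph {V : Type*} (Γ : SimpleGraph V) :
    SimpleGraph {s : Set V // IsFourCycleSet Γ s} :=
  SimpleGraph.fromRel fun s t =>
    ∃ a b : V, a ≠ b ∧ ¬ Γ.Adj a b ∧ a ∈ s.1 ∩ t.1 ∧ b ∈ s.1 ∩ t.1

/-- `Γ` is CFS: `Γ = Ω * K` with `K` a (possibly empty) clique and `Ω` nonempty such that
`Ω⁴` has a connected component whose support is all of `V(Ω)`. -/
def CFS {V : Type*} (Γ : SimpleGraph V) : Prop :=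
  ∃ Ω K : Set V, Ω ∪ K = Set.univ ∧ Disjoint Ω K ∧ Ω.Nonempty ∧
    (∀ a ∈ K, ∀ b ∈ K, a ≠ b → Γ.Adj a b) ∧
    (∀ a ∈ Ω, ∀ b ∈ K, Γ.Adj a b) ∧
    ∃ s₀ : {s : Set ↥Ω // IsFourCycleSet (Γ.induce Ω) s},
      ∀ v : ↥Ω, ∃ t : {s : Set ↥Ω // IsFourCycleSet (Γ.induce Ω) s},
        (fourCycleGraph (Γ.induce Ω)).Reachable s₀ t ∧ v ∈ t.1

/-- A (topological) planar embedding of the graph `Γ`: vertices go to distinct points of the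
plane, each edge to an arc between the images of its endpoints, arcs meeting only at common
endpoint vertices. -/
structure PlanarEmbedding {V : Type*} (Γ : SimpleGraph V) where
  vmap : V → ℝ × ℝ
  inj : Function.Injective vmap
  emap : Sym2 V → Set (ℝ × ℝ)
  arc : ∀ ⦃u v : V⦄, Γ.Adj u v → ∃ γ : Path (vmap u) (vmap v),
    Function.Injective (⇑γ) ∧ Set.range (⇑γ) = emap s(u, v)
  disjointEdges : ∀ e ∈ Γ.edgeSet, ∀ e' ∈ Γ.edgeSet, e ≠ e' →
    emap e ∩ emap e' ⊆ Set.range vmap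
  vertexOnEdge : ∀ e ∈ Γ.edgeSet, ∀ v : V, vmap v ∈ emap e → v ∈ e

/-- The image in the plane of the full subgraph of `Γ` spanned by the vertex set `W`. -/
def PlanarEmbedding.imageOf {V : Type*} {Γ : SimpleGraph V} (f : PlanarEmbedding Γ)
    (W : Set V) : Set (ℝ × ℝ) :=
  (f.vmap '' W) ∪ ⋃ (e : Sym2 V) (_ : e ∈ Γ.edgeSet) (_ : ∀ x ∈ e, x ∈ W), f.emap e

/-- The 4-cycle `c` strongly separates the subgraph of `Γ` spanned by `W` with respect to the
embedding `f`: the image of the subgraph meets (at least) two distinct connected components of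
the complement of the image of `c`. -/
def StronglySeparatesIn {V : Type*} {Γ : SimpleGraph V} (f : PlanarEmbedding Γ)
    (c : Fin 4 → V) (W : Set V) : Prop :=
  ∃ x y : ℝ × ℝ, x ∈ f.imageOf W ∧ y ∈ f.imageOf W ∧
    x ∉ f.imageOf (Set.range c) ∧ y ∉ f.imageOf (Set.range c) ∧
    y ∉ connectedComponentIn (f.imageOf (Set.range c))ᶜ x

/-- `(W₁, W₂)` is a strong visual decomposition of `Γ` along the induced 4-cycle `c`
with respect to the embedding `f`. -/
def StrongVisualDecomposition {V : Type*} {Γ : SimpleGraph V} (f : PlanarEmbedding Γ)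
    (c : Fin 4 → V) (W₁ W₂ : Set V) : Prop :=
  IsInducedFourCycle Γ c ∧
  W₁ ∪ W₂ = Set.univ ∧ W₁ ∩ W₂ = Set.range c ∧
  (W₁ \ Set.range c).Nonempty ∧ (W₂ \ Set.range c).Nonempty ∧
  (∀ v ∈ W₁ \ Set.range c, ∀ w ∈ W₂ \ Set.range c,
    f.vmap w ∉ connectedComponentIn (f.imageOf (Set.range c))ᶜ (f.vmap v)) ∧
  (∀ u v : V, Γ.Adj u v → (u ∈ W₁ ∧ v ∈ W₁) ∨ (u ∈ W₂ ∧ v ∈ W₂))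

/-- Standing Assumptions: connected, triangle-free, planar, at least five vertices,
no separating vertices or edges. -/
def StandingAssumptions {V : Type*} (Γ : SimpleGraph V) : Prop :=
  Γ.Connected ∧ Γ.CliqueFree 3 ∧ Nonempty (PlanarEmbedding Γ) ∧ 5 ≤ Nat.card V ∧
  (∀ v : V, (Γ.induce ({v}ᶜ : Set V)).Connected) ∧
  (∀ u v : V, Γ.Adj u v → (Γ.induce ({u, v}ᶜ : Set V)).Connected)

/-- `Γ` contains (as a subgraph) a suspension of three distinct points. -/
def ContainsSuspThree {V : Type*} (Γ : SimpleGraph V) : Prop :=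
  ∃ (a : Fin 3 → V) (b : Fin 2 → V), Function.Injective a ∧ Function.Injective b ∧
    (∀ i j, a i ≠ b j) ∧ ∀ i j, Γ.Adj (a i) (b j)

/-- `Γ` is (exactly) the suspension of three distinct points. -/
def IsSuspensionOfThreePoints {V : Type*} (Γ : SimpleGraph V) : Prop :=
  ∃ (a : Fin 3 → V) (b : Fin 2 → V), Function.Injective a ∧ Function.Injective b ∧
    (∀ i j, a i ≠ b j) ∧ Set.range a ∪ Set.range b = Set.univ ∧
    ∀ x y : V, Γ.Adj x y ↔ ((∃ i j, x = a i ∧ y = b j) ∨ (∃ i j, x = b j ∧ y = a i))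

/-- `Γ` is a suspension of a set of distinct (pairwise non-adjacent) vertices. -/
def IsSuspension {V : Type*} (Γ : SimpleGraph V) : Prop :=
  ∃ b₁ b₂ : V, b₁ ≠ b₂ ∧ ¬ Γ.Adj b₁ b₂ ∧
    (∀ v, v ≠ b₁ → v ≠ b₂ → Γ.Adj v b₁ ∧ Γ.Adj v b₂) ∧
    (∀ u v, u ≠ b₁ → u ≠ b₂ → v ≠ b₁ → v ≠ b₂ → ¬ Γ.Adj u v)

/-- `Γ` is a join of two nonempty subgraphs. -/
def IsJoin {V : Type*} (Γ : SimpleGraph V) : Prop :=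
  ∃ A B : Set V, A.Nonempty ∧ B.Nonempty ∧ Disjoint A B ∧ A ∪ B = Set.univ ∧
    ∀ a ∈ A, ∀ b ∈ B, Γ.Adj a b

/-- `Γ` is prime: not a 4-cycle, and some planar embedding has no strongly separating
4-cycle. -/
def IsPrime {V : Type*} (Γ : SimpleGraph V) : Prop :=
  (¬ ∃ c : Fin 4 → V, IsInducedFourCycle Γ c ∧ Set.range c = Set.univ) ∧
  ∃ f : PlanarEmbedding Γ, ∀ c : Fin 4 → V, IsInducedFourCycle Γ c →
    ¬ StronglySeparatesIn f c Set.univ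

/-- The closed half-space model for 3-manifolds with boundary. -/
def HalfSpace3 : Set (Fin 3 → ℝ) := {y | 0 ≤ y 0}

/-- A topological 3-manifold, possibly with boundary. -/
def IsManifold3WithBoundary (M : Type*) [TopologicalSpace M] : Prop :=
  T2Space M ∧ SecondCountableTopology M ∧ ∀ x : M, ∃ U : Set M, IsOpen U ∧ x ∈ U ∧
    ∃ W : Set ↥HalfSpace3, IsOpen W ∧ Nonempty (↥U ≃ₜ ↥W)

/-- A compact 3-manifold foliated by circles (Seifert fibered, by Epstein's theorem). -/
def SeifertLike (M : Type*) [TopologicalSpace M] : Prop :=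
  IsManifold3WithBoundary M ∧ CompactSpace M ∧ Nonempty M ∧
  ∃ (B : Type) (_ : TopologicalSpace B) (p : M → B),
    Continuous p ∧ Function.Surjective p ∧ ∀ b : B, Nonempty (↥(p ⁻¹' {b}) ≃ₜ Circle)

abbrev Torus : Type := Circle × Circle

/-- A (non-geometric) graph manifold: a compact 3-manifold, not itself Seifert fibered,
which is a union of finitely many closed Seifert pieces meeting along disjoint unions of
tori. -/
def IsGraphManifold (M : Type*) [TopologicalSpace M] : Prop :=
  IsManifold3WithBoundary M ∧ CompactSpace M ∧ ¬ SeifertLike M ∧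
  ∃ (n : ℕ) (P : Fin n → Set M),
    (⋃ i, P i) = Set.univ ∧
    (∀ i, IsClosed (P i) ∧ SeifertLike ↥(P i)) ∧
    ∀ i j, i ≠ j → ∃ k : ℕ, Nonempty (↥(P i ∩ P j) ≃ₜ (Fin k × Torus))

/-- A pointed topological space. -/
structure PointedSpace where
  carrier : Type
  top : TopologicalSpace carrier
  pt : carrier

attribute [instance] PointedSpace.top

/-- `G` is virtually the fundamental group of a Seifert fibered 3-manifold. -/
def VirtuallySeifert (G : Type*) [Group G] : Prop :=
  ∃ H : Subgroup G, H.FiniteIndex ∧ ∃ X : PointedSpace,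
    SeifertLike X.carrier ∧ Nonempty (H ≃* FundamentalGroup X.carrier X.pt)

/-- `G` is virtually the fundamental group of a graph manifold. -/
def VirtuallyGraphManifold (G : Type*) [Group G] : Prop :=
  ∃ H : Subgroup G, H.FiniteIndex ∧ ∃ X : PointedSpace,
    IsGraphManifold X.carrier ∧ Nonempty (H ≃* FundamentalGroup X.carrier X.pt)

/-- A vertex-colored graph. -/
structure ColoredGraph (C : Type*) where
  V : Type
  graph : SimpleGraph V
  color : V → C

/-- A weak covering of colored graphs: a color-preserving graph homomorphism with the
edge-lifting property. -/
def WeakCovering {C : Type*} (Λ Λ' : ColoredGraph C) (f : Λ.V → Λ'.V) : Prop :=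
  (∀ v, Λ'.color (f v) = Λ.color v) ∧
  (∀ v w, Λ.graph.Adj v w → Λ'.graph.Adj (f v) (f w)) ∧
  (∀ v w', Λ'.graph.Adj (f v) w' → ∃ w, Λ.graph.Adj v w ∧ f w = w')

/-- Two colored graphs are bisimilar if they weakly cover a common colored graph. -/
def Bisimilar {C : Type*} (Λ₁ Λ₂ : ColoredGraph C) : Prop :=
  ∃ (Λ : ColoredGraph C) (f₁ : Λ₁.V → Λ.V) (f₂ : Λ₂.V → Λ.V),
    WeakCovering Λ₁ Λ f₁ ∧ WeakCovering Λ₂ Λ f₂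

/-- Isomorphism of colored graphs. -/
def ColoredIso {C : Type*} (Λ₁ Λ₂ : ColoredGraph C) : Prop :=
  ∃ e : Λ₁.V ≃ Λ₂.V, (∀ v, Λ₂.color (e v) = Λ₁.color v) ∧
    ∀ v w, Λ₁.graph.Adj v w ↔ Λ₂.graph.Adj (e v) (e w)
/-- A visual decomposition tree of a CFS graph `Γ` satisfying the Standing Assumptions:
a finite tree whose vertices carry suspension subgraphs `Γv t = susp(Av t)` (with the two
suspension points `pole1 t`, `pole2 t`), glued along induced 4-cycles. -/
structure VisualDecompTree (V : Type*) (Γ : SimpleGraph V) where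
  T : Type
  finite : Finite T
  tree : SimpleGraph T
  isTree : tree.IsTree
  Γv : T → Set V
  Av : T → Set V
  pole1 : T → V
  pole2 : T → V
  susp : ∀ t : T,
    pole1 t ≠ pole2 t ∧ ¬ Γ.Adj (pole1 t) (pole2 t) ∧
    Γv t = Av t ∪ {pole1 t, pole2 t} ∧ pole1 t ∉ Av t ∧ pole2 t ∉ Av t ∧
    (∀ a ∈ Av t, Γ.Adj a (pole1 t) ∧ Γ.Adj a (pole2 t)) ∧
    (∀ a ∈ Av t, ∀ b ∈ Av t, ¬ Γ.Adj a b)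
  three : ∀ t : T, 3 ≤ Nat.card (Av t)
  distinct : Function.Injective Γv
  covers : (⋃ t : T, Γv t) = Set.univ
  edges4 : ∀ t₁ t₂ : T, tree.Adj t₁ t₂ →
    Γv t₁ ∩ Γv t₂ = {pole1 t₁, pole2 t₁, pole1 t₂, pole2 t₂} ∧
    IsFourCycleSet Γ (Γv t₁ ∩ Γv t₂)
  nonedges : ∀ t₁ t₂ : T, t₁ ≠ t₂ → ¬ tree.Adj t₁ t₂ →
    ¬ IsFourCycleSet Γ (Γv t₁ ∩ Γv t₂)
  polesIn : ∀ t₁ t₂ : T, tree.Adj t₁ t₂ → pole1 t₁ ∈ Av t₂ ∧ pole2 t₁ ∈ Av t₂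

/-- The weight of a vertex of a visual decomposition tree. -/
noncomputable def VisualDecompTree.weight {V : Type*} {Γ : SimpleGraph V} (D : VisualDecompTree V Γ)
    (t : D.T) : ℕ := Nat.card (D.Av t)

/-- The degree of a vertex of a visual decomposition tree. -/
noncomputable def VisualDecompTree.degree {V : Type*} {Γ : SimpleGraph V} (D : VisualDecompTree V Γ)
    (t : D.T) : ℕ := Nat.card (D.tree.neighborSet t)

/-- A vertex is black if its weight strictly exceeds its degree (white otherwise). -/
def VisualDecompTree.Black {V : Type*} {Γ : SimpleGraph V} (D : VisualDecompTree V Γ)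
    (t : D.T) : Prop := D.degree t < D.weight t

/-- The visual decomposition tree as a colored graph (colored by the black/white property). -/
def VisualDecompTree.colored {V : Type*} {Γ : SimpleGraph V} (D : VisualDecompTree V Γ) :
    ColoredGraph Prop :=
  ⟨D.T, D.tree, fun t => D.Black t⟩


theorem wordDist_le {G : Type*} [Group G] {S : Set G} {g h : G} (w : List G)
    (hw : ∀ x ∈ w, x ∈ S ∨ x⁻¹ ∈ S) (hp : g⁻¹ * h = w.prod) : wordDist S g h ≤ w.length :=
  Nat.sInf_le ⟨w, rfl, hw, hp⟩

theorem exists_word_length_eq_wordDist {G : Type*} [Group G] {S : Set G}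
    (hS : Subgroup.closure S = ⊤) (g h : G) :
    ∃ w : List G, w.length = wordDist S g h ∧ (∀ x ∈ w, x ∈ S ∨ x⁻¹ ∈ S) ∧ g⁻¹ * h = w.prod := by
  refine Nat.sInf_mem (s := {n | ∃ w : List G, w.length = n ∧
    (∀ x ∈ w, x ∈ S ∨ x⁻¹ ∈ S) ∧ g⁻¹ * h = w.prod}) ?_
  obtain ⟨w, hw, hp⟩ := Submonoid.exists_list_of_mem_closure
    (show g⁻¹ * h ∈ Submonoid.closure (S ∪ S⁻¹) by
      rw [← Subgroup.closure_toSubmonoid, hS]; trivial)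
  exact ⟨w.length, w, rfl, hw, hp.symm⟩

theorem wordDist_mul_left {G : Type*} [Group G] (S : Set G) (a g h : G) :
    wordDist S (a * g) (a * h) = wordDist S g h := by
  simp only [wordDist, mul_inv_rev, mul_assoc, inv_mul_cancel_left]

theorem wordDist_comm {G : Type*} [Group G] {S : Set G} (hS : Subgroup.closure S = ⊤) (g h : G) :
    wordDist S g h = wordDist S h g := by
  have key : ∀ g h : G, wordDist S g h ≤ wordDist S h g := by
    intro g h
    obtain ⟨w, hl, hw, hp⟩ := exists_word_length_eq_wordDist hS h g
    rw [← hl]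
    refine (wordDist_le (w.map (·⁻¹)).reverse ?_ ?_).trans (by simp)
    · intro x hx
      simp only [List.mem_reverse, List.mem_map] at hx
      obtain ⟨y, hy, rfl⟩ := hx
      simpa using (hw y hy).symm
    · rw [← List.prod_inv_reverse, ← hp]
      group
  exact le_antisymm (key g h) (key h g)

theorem wordDist_triangle {G : Type*} [Group G] {S : Set G} (hS : Subgroup.closure S = ⊤)
    (g h k : G) : wordDist S g k ≤ wordDist S g h + wordDist S h k := by
  obtain ⟨w, hl, hw, hp⟩ := exists_word_length_eq_wordDist hS g h
  obtain ⟨w', hl', hw', hp'⟩ := exists_word_length_eq_wordDist hS h k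
  rw [← hl, ← hl', ← List.length_append]
  refine wordDist_le _ (fun x hx => (List.mem_append.1 hx).elim (hw x) (hw' x)) ?_
  rw [List.prod_append, ← hp, ← hp']
  group

/-- Any two points are joined by a discrete geodesic. -/
theorem exists_geodesic {G : Type*} [Group G] {S : Set G} (hS : Subgroup.closure S = ⊤)
    (g h : G) : ∃ γ : ℕ → G, γ 0 = g ∧ γ (wordDist S g h) = h ∧
      ∀ i j, i ≤ j → j ≤ wordDist S g h → wordDist S (γ i) (γ j) = j - i := by
  obtain ⟨w, hl, hw, hp⟩ := exists_word_length_eq_wordDist hS g h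
  have hle : ∀ i j, i ≤ j → j ≤ wordDist S g h →
      wordDist S (g * (w.take i).prod) (g * (w.take j).prod) ≤ j - i := by
    intro i j hij hj
    rw [wordDist_mul_left]
    refine (wordDist_le ((w.take j).drop i) ?_ ?_).trans (by simp; omega)
    · exact fun x hx => hw x (List.mem_of_mem_take (List.mem_of_mem_drop hx))
    · have h1 := List.prod_take_mul_prod_drop (w.take j) i
      rw [List.take_take, min_eq_left hij] at h1
      rw [← h1]
      group
  have h0 : g * (w.take 0).prod = g := by simp
  have h1 : g * (w.take (wordDist S g h)).prod = h := by
    rw [← hl, List.take_length, ← hp]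
    group
  refine ⟨fun i => g * (w.take i).prod, h0, h1, fun i j hij hj => ?_⟩
  have e1 := hle 0 i (Nat.zero_le _) (hij.trans hj)
  have e2 := hle i j hij hj
  have e3 := hle j _ hj le_rfl
  have t1 := wordDist_triangle hS g (g * (w.take i).prod) h
  have t2 := wordDist_triangle hS (g * (w.take i).prod) (g * (w.take j).prod) h
  rw [h0] at e1
  rw [h1] at e3
  dsimp only
  omega

theorem finite_wordDist_ball {G : Type*} [Group G] {S : Set G} (hS : Subgroup.closure S = ⊤)
    (hfin : S.Finite) (N : ℕ) : {g | wordDist S 1 g ≤ N}.Finite := by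
  have hT : {x | x ∈ S ∨ x⁻¹ ∈ S}.Finite := hfin.union (hfin.preimage inv_injective.injOn)
  have := hT.to_subtype
  refine ((List.finite_length_le {x | x ∈ S ∨ x⁻¹ ∈ S} N).image
    (fun l => (l.map Subtype.val).prod)).subset ?_
  intro g hg
  obtain ⟨w, hl, hw, hp⟩ := exists_word_length_eq_wordDist hS 1 g
  lift w to List {x | x ∈ S ∨ x⁻¹ ∈ S} using hw
  refine ⟨w, ?_, by simpa using hp.symm⟩
  simp only [List.length_map] at hl
  exact hl.trans_le hg

theorem isQuasiGeodesic_of_le {G : Type*} [Group G] {S : Set G} (hS : Subgroup.closure S = ⊤)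
    {n : ℕ} (p : ℕ → G)
    (hp : ∀ i j, i ≤ j → j ≤ n →
      wordDist S (p i) (p j) ≤ j - i ∧ j - i ≤ 3 * wordDist S (p i) (p j)) :
    IsQuasiGeodesic S 3 0 (fun i : Fin (n + 1) => p i) := by
  have key : ∀ i j, i ≤ j → j ≤ n →
      (wordDist S (p i) (p j) : ℝ) ≤ 3 * |(i : ℝ) - (j : ℝ)| + 0 ∧
        |(i : ℝ) - (j : ℝ)| / 3 - 0 ≤ (wordDist S (p i) (p j) : ℝ) := by
    intro i j hij hj
    obtain ⟨h1, h2⟩ := hp i j hij hj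
    have h3 : |(i : ℝ) - (j : ℝ)| = ((j - i : ℕ) : ℝ) := by
      rw [abs_sub_comm, Nat.cast_sub hij, abs_of_nonneg]
      exact sub_nonneg.2 (Nat.cast_le.2 hij)
    have h1' : (wordDist S (p i) (p j) : ℝ) ≤ ((j - i : ℕ) : ℝ) := by exact_mod_cast h1
    have h2' : ((j - i : ℕ) : ℝ) ≤ 3 * (wordDist S (p i) (p j) : ℝ) := by exact_mod_cast h2
    have h4 : (0 : ℝ) ≤ ((j - i : ℕ) : ℝ) := Nat.cast_nonneg _
    rw [h3]
    constructor <;> linarith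
  intro i j
  rcases le_total (i : ℕ) (j : ℕ) with h | h
  · exact key i j h (by omega)
  · have := key j i h (by omega)
    rwa [wordDist_comm hS, abs_sub_comm] at this

/-- If a geodesic from `g` to `k` is long compared with the distances from `x` to `g` and from
`y` to `k`, then a central point of it lies on a `(3, 0)`-quasi-geodesic from `x` to `y`. -/
theorem exists_isQuasiGeodesic_through {G : Type*} [Group G] {S : Set G}
    (hS : Subgroup.closure S = ⊤) {x y : G} {R L s : ℕ} (m : ℕ → G)
    (hm : ∀ i j, i ≤ j → j ≤ L → wordDist S (m i) (m j) = j - i)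
    (hx : wordDist S x (m 0) ≤ R) (hy : wordDist S (m L) y ≤ R)
    (hxy : L ≤ wordDist S x y) (hL : 4 * R ≤ L) (hs : 2 * R ≤ s) (hs' : s + 2 * R ≤ L) :
    ∃ (n : ℕ) (q : Fin (n + 1) → G), q 0 = x ∧ q (Fin.last n) = y ∧
      IsQuasiGeodesic S 3 0 q ∧ ∃ i, q i = m s := by
  obtain ⟨u, hu, humin⟩ := Finset.exists_min_image (Finset.range (L + 1))
    (fun i => wordDist S x (m i)) ⟨0, by simp⟩
  obtain ⟨v, hv, hvmin⟩ := Finset.exists_min_image (Finset.range (L + 1))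
    (fun i => wordDist S (m i) y) ⟨0, by simp⟩
  simp only [Finset.mem_range, Nat.lt_succ_iff] at hu humin hv hvmin
  have ha : wordDist S x (m u) ≤ R := (humin 0 (Nat.zero_le _)).trans hx
  have hb : wordDist S (m v) y ≤ R := (hvmin L le_rfl).trans hy
  have hu2 : u ≤ 2 * R := by
    have h1 := wordDist_triangle hS (m 0) x (m u)
    rw [hm 0 u (Nat.zero_le _) hu, wordDist_comm hS (m 0) x] at h1
    omega
  have hv2 : L ≤ v + 2 * R := by
    have h1 := wordDist_triangle hS (m v) y (m L)
    rw [hm v L hv le_rfl, wordDist_comm hS y (m L)] at h1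
    omega
  obtain ⟨α, hα0, hα1, hα⟩ := exists_geodesic hS x (m u)
  obtain ⟨β, hβ0, hβ1, hβ⟩ := exists_geodesic hS (m v) y
  set a := wordDist S x (m u)
  set b := wordDist S (m v) y
  have hαx : ∀ i ≤ a, wordDist S x (α i) = i := fun i hi => by
    simpa [hα0] using hα 0 i (Nat.zero_le _) hi
  have hαm : ∀ i ≤ a, wordDist S (α i) (m u) = a - i := fun i hi => by
    simpa [hα1] using hα i a hi le_rfl
  have hβm : ∀ i ≤ b, wordDist S (m v) (β i) = i := fun i hi => by
    simpa [hβ0] using hβ 0 i (Nat.zero_le _) hi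
  have hβy : ∀ i ≤ b, wordDist S (β i) y = b - i := fun i hi => by
    simpa [hβ1] using hβ i b hi le_rfl
  have hαM : ∀ i ≤ a, ∀ j, u ≤ j → j ≤ v → wordDist S (α i) (m j) ≤ (a - i) + (j - u) ∧
      (a - i) + (j - u) ≤ 3 * wordDist S (α i) (m j) := by
    intro i hi j hj hjv
    have t1 := wordDist_triangle hS (α i) (m u) (m j)
    have t2 := wordDist_triangle hS x (α i) (m j)
    have t3 := wordDist_triangle hS (m u) (α i) (m j)
    have e1 := humin j (hjv.trans hv)
    rw [wordDist_comm hS (m u) (α i)] at t3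
    rw [hαm i hi, hm u j hj (hjv.trans hv)] at t1 t3
    rw [hαx i hi] at t2
    omega
  have hMβ : ∀ i, u ≤ i → i ≤ v → ∀ j ≤ b, wordDist S (m i) (β j) ≤ (v - i) + j ∧
      (v - i) + j ≤ 3 * wordDist S (m i) (β j) := by
    intro i hi hiv j hj
    have t1 := wordDist_triangle hS (m i) (m v) (β j)
    have t2 := wordDist_triangle hS (m i) (β j) y
    have t3 := wordDist_triangle hS (m i) (β j) (m v)
    have e1 := hvmin i (hiv.trans hv)
    rw [wordDist_comm hS (β j) (m v)] at t3
    rw [hβm j hj, hm i v hiv hv] at t1 t3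
    rw [hβy j hj] at t2
    omega
  have hαβ : ∀ i ≤ a, ∀ j ≤ b, wordDist S (α i) (β j) ≤ (a - i) + (v - u) + j ∧
      (a - i) + (v - u) + j ≤ 3 * wordDist S (α i) (β j) := by
    intro i hi j hj
    have t1 := wordDist_triangle hS (α i) (m v) (β j)
    have t2 := (hαM i hi v (by omega) le_rfl).1
    have t3 := wordDist_triangle hS x (α i) y
    have t4 := wordDist_triangle hS (α i) (β j) y
    rw [hβm j hj] at t1
    rw [hαx i hi] at t3
    rw [hβy j hj] at t4
    omega
  let p : ℕ → G := fun i =>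
    if i ≤ a then α i else if i ≤ a + (v - u) then m (u + (i - a)) else β (i - a - (v - u))
  have hp1 : ∀ i, i ≤ a → p i = α i := fun i hi => by simp [p, hi]
  have hp2 : ∀ i, a < i → i ≤ a + (v - u) → p i = m (u + (i - a)) := fun i hi hi' => by
    simp [p, hi, hi']
  have hp3 : ∀ i, a + (v - u) < i → p i = β (i - a - (v - u)) := fun i hi => by
    simp only [p, if_neg (show ¬ i ≤ a by omega), if_neg (show ¬ i ≤ a + (v - u) by omega)]
  have hpq : ∀ i j, i ≤ j → j ≤ a + (v - u) + b →
      wordDist S (p i) (p j) ≤ j - i ∧ j - i ≤ 3 * wordDist S (p i) (p j) := by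
    intro i j hij hj
    rcases le_or_gt i a with hi | hi
    · rw [hp1 i hi]
      rcases le_or_gt j a with hja | hja
      · rw [hp1 j hja, hα i j hij hja]
        omega
      rcases le_or_gt j (a + (v - u)) with hjv | hjv
      · rw [hp2 j hja hjv]
        have := hαM i hi (u + (j - a)) (by omega) (by omega)
        omega
      · rw [hp3 j hjv]
        have := hαβ i hi (j - a - (v - u)) (by omega)
        omega
    · rcases le_or_gt i (a + (v - u)) with hiv | hiv
      · rw [hp2 i hi hiv]
        rcases le_or_gt j (a + (v - u)) with hjv | hjv
        · rw [hp2 j (by omega) hjv, hm _ _ (by omega) (by omega)]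
          omega
        · rw [hp3 j hjv]
          have := hMβ (u + (i - a)) (by omega) (by omega) (j - a - (v - u)) (by omega)
          omega
      · rw [hp3 i hiv, hp3 j (by omega), hβ _ _ (by omega) (by omega)]
        omega
  refine ⟨a + (v - u) + b, fun i => p i, ?_, ?_, isQuasiGeodesic_of_le hS p hpq,
    ⟨a + (s - u), by omega⟩, ?_⟩
  · simp [hp1 0 (Nat.zero_le _), hα0]
  · change p (a + (v - u) + b) = y
    rcases Nat.eq_zero_or_pos b with hb0 | hb0
    · have hvy : m v = y := by rw [← hβ0, ← hβ1, hb0]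
      rcases Nat.eq_zero_or_pos (v - u) with huv | huv
      · rw [hp1 _ (by omega), ← hvy, show v = u by omega, ← hα1]
        congr 1
        omega
      · rw [hp2 _ (by omega) (by omega), ← hvy]
        congr 1
        omega
    · rw [hp3 _ (by omega), ← hβ1]
      congr 1
      omega
  · change p (a + (s - u)) = m s
    rcases Nat.eq_zero_or_pos (s - u) with hsu | hsu
    · rw [hp1 _ (by omega), show s = u by omega, ← hα1]
      congr 1
      omega
    · rw [hp2 _ (by omega) (by omega)]
      congr 1
      omega

/-- Elements commuting with an infinite subset of a strongly quasiconvex subgroup `H` lie in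
finitely many right cosets of `H`. -/
theorem StronglyQuasiconvex.finite_image_mk_inv {G : Type*} [Group G] {S : Set G}
    (hS : Subgroup.closure S = ⊤) (hfin : S.Finite) {H : Subgroup G}
    (hsqc : StronglyQuasiconvex S (H : Set G)) {A B : Set G} (hA : A.Infinite)
    (hAH : A ⊆ H) (hAB : ∀ a ∈ A, ∀ b ∈ B, a * b = b * a) :
    ((fun g : G => ((g⁻¹ : G) : G ⧸ H)) '' B).Finite := by
  classical
  obtain ⟨M, hM⟩ := hsqc 3 0 (by norm_num) le_rfl
  have hball := finite_wordDist_ball hS hfin ⌊M⌋₊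
  by_contra hinf
  obtain ⟨T, hTB, hTcard⟩ := Set.Infinite.exists_subset_card_eq hinf (hball.toFinset.card + 1)
  choose! r hrB hr using fun c (hc : c ∈ T) => hTB hc
  set R := T.sup fun c => wordDist S 1 (r c)
  have hR : ∀ c ∈ T, wordDist S 1 (r c) ≤ R := fun c hc =>
    Finset.le_sup (f := fun c => wordDist S 1 (r c)) hc
  obtain ⟨h, hhA, hhL⟩ : ∃ h ∈ A, 4 * R < wordDist S 1 h := by
    by_contra! hcon
    exact hA ((finite_wordDist_ball hS hfin (4 * R)).subset hcon)
  obtain ⟨γ, hγ0, hγ1, hγ⟩ := exists_geodesic hS 1 h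
  have hnear : ∀ c ∈ T, ∃ k ∈ H, wordDist S 1 (k⁻¹ * (r c * γ (2 * R))) ≤ ⌊M⌋₊ := by
    intro c hc
    obtain ⟨n, q, hq0, hq1, hq, i, hi⟩ := exists_isQuasiGeodesic_through hS
      (x := 1) (y := h) (R := R) (s := 2 * R) (fun i => r c * γ i)
      (fun i j hij hj => by rw [wordDist_mul_left, hγ i j hij hj])
      (by simpa [hγ0] using hR c hc)
      (by
        rw [hγ1, ← hAB h hhA (r c) (hrB c hc), wordDist_comm hS]
        conv_lhs => rw [← mul_one h, mul_assoc, one_mul, wordDist_mul_left]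
        exact hR c hc)
      le_rfl (by omega) le_rfl (by omega)
    obtain ⟨k, hk, hkM⟩ := hM n q (hq0 ▸ H.one_mem) (hq1 ▸ hAH hhA) hq i
    refine ⟨k, hk, Nat.le_floor ?_⟩
    rw [← wordDist_mul_left S k, mul_one, mul_inv_cancel_left, wordDist_comm hS, ← hi]
    exact hkM
  choose! k hkH hkM using hnear
  obtain ⟨c, hc, c', hc', hne, heq⟩ := Finset.exists_ne_map_eq_of_card_lt_of_maps_to
    (s := T) (t := hball.toFinset) (by omega)
    (f := fun c => (k c)⁻¹ * (r c * γ (2 * R)))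
    (fun c hc => by simpa using hkM c hc)
  apply hne
  rw [← hr c hc, ← hr c' hc']
  refine QuotientGroup.eq.2 ?_
  have : (r c)⁻¹⁻¹ * (r c')⁻¹ = k c * (k c')⁻¹ := by
    simp only [← mul_assoc, mul_left_inj] at heq
    rw [inv_inv, mul_inv_eq_iff_eq_mul, mul_assoc, ← heq, mul_inv_cancel_left]
  rw [this]
  exact H.mul_mem (hkH c hc) (H.inv_mem (hkH c' hc'))

/-- A finitely generated group with infinite center has no infinite strongly
quasiconvex subgroup of infinite index. -/
theorem stmt_1 {G : Type} [Group G] (S : Finset G)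
    (hS : Subgroup.closure (S : Set G) = ⊤)
    (hZ : (Subgroup.center G : Set G).Infinite)
    (H : Subgroup G) (hHinf : (H : Set G).Infinite)
    (hsqc : StronglyQuasiconvex (S : Set G) (H : Set G)) :
    H.FiniteIndex := by
  have hfin : (S : Set G).Finite := S.finite_toSet
  have hZH : ((Subgroup.center G : Set G) ∩ H).Infinite := by
    have himg := hsqc.finite_image_mk_inv hS hfin hHinf subset_rfl
      (B := (Subgroup.center G : Set G))
      (fun a _ b hb => Subgroup.mem_center_iff.1 hb a)
    intro hcon
    refine hZ (Set.Finite.of_finite_fibers _ himg ?_)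
    rintro _ ⟨g, hg, rfl⟩
    refine Set.Finite.of_finite_image (f := fun x => g * x⁻¹) (hcon.subset ?_) ?_
    · rintro _ ⟨x, ⟨hx, hxg⟩, rfl⟩
      refine ⟨mul_mem hg (inv_mem hx), ?_⟩
      simpa using QuotientGroup.eq.1 (Eq.symm hxg)
    · intro x _ y _ hxy
      simpa using hxy
  have himg := hsqc.finite_image_mk_inv hS hfin hZH Set.inter_subset_right (B := Set.univ)
    (fun a ha b _ => (Subgroup.mem_center_iff.1 ha.1 b).symm)
  rw [Subgroup.finiteIndex_iff_finite_quotient, ← Set.finite_univ_iff]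
  refine himg.subset fun c _ => ?_
  obtain ⟨g, rfl⟩ := QuotientGroup.mk_surjective c
  exact ⟨g⁻¹, trivial, by simp⟩

end Paper
end

section
/- Let Γ be a prime graph satisfying the Standing Assumptions. Then either Γ is the suspension of 3 distinct points, or Γ contains no subgraph that is a suspension of 3 distinct points. In particular, if Γ is additionally CFS, then Γ is the suspension of exactly 3 distinct points. -/
open Set

namespace Paper

/-- Every nowhere vanishing continuous function on the unit square has a continuous logarithm. -/
theorem exists_continuous_log_unitSquare (f : unitInterval × unitInterval → ℂ)
    (hf : Continuous f) (h0 : ∀ x, f x ≠ 0) :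
    ∃ l : unitInterval × unitInterval → ℂ, Continuous l ∧ ∀ x, Complex.exp (l x) = f x := by
  let r : C(ℝ × ℝ, unitInterval × unitInterval) :=
    ⟨Prod.map (projIcc 0 1 zero_le_one) (projIcc 0 1 zero_le_one),
      continuous_projIcc.prodMap continuous_projIcc⟩
  obtain ⟨l, ⟨-, hl⟩, -⟩ := Complex.isCoveringMapOn_exp.existsUnique_continuousMap_lifts
    ((⟨f, hf⟩ : C(unitInterval × unitInterval, ℂ)).comp r) (a₀ := (0, 0))
    (Complex.exp_log (h0 (r (0, 0)))) (fun x ↦ h0 (r x))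
  refine ⟨fun x ↦ l (x.1, x.2), by fun_prop, fun x ↦ ?_⟩
  have := congr_fun hl (x.1, x.2)
  simpa [r] using this

/-- Every nowhere vanishing continuous function on the unit interval has a continuous logarithm. -/
theorem exists_continuous_log_unitInterval (f : unitInterval → ℂ)
    (hf : Continuous f) (h0 : ∀ x, f x ≠ 0) :
    ∃ l : unitInterval → ℂ, Continuous l ∧ ∀ x, Complex.exp (l x) = f x := by
  obtain ⟨l, hl, h⟩ := exists_continuous_log_unitSquare (fun x ↦ f x.1) (by fun_prop)
    (fun x ↦ h0 x.1)
  exact ⟨fun t ↦ l (t, 0), by fun_prop, fun t ↦ h (t, 0)⟩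

open Classical in
/-- The variation of a continuous logarithm of `f` along the unit interval. -/
noncomputable def logVar (f : unitInterval → ℂ) : ℂ :=
  if h : ∃ l : unitInterval → ℂ, Continuous l ∧ ∀ t, Complex.exp (l t) = f t then
    h.choose 1 - h.choose 0
  else 0

theorem logVar_eq {f l : unitInterval → ℂ} (hl : Continuous l)
    (h : ∀ t, Complex.exp (l t) = f t) : logVar f = l 1 - l 0 := by
  have hex : ∃ l : unitInterval → ℂ, Continuous l ∧ ∀ t, Complex.exp (l t) = f t := ⟨l, hl, h⟩
  rw [logVar, dif_pos hex]
  obtain ⟨hc, he⟩ := hex.choose_spec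
  set k := hex.choose
  have key := Complex.isCoveringMap_exp.eq_of_comp_eq (g₁ := k)
    (g₂ := fun t ↦ l t + (k 0 - l 0)) hc (by fun_prop) (by
      ext t
      have h0 : f 0 ≠ 0 := h 0 ▸ Complex.exp_ne_zero _
      simp [Complex.exp_add, Complex.exp_sub, h, he, h0]) 0 (by simp)
  rw [congr_fun key 1]
  ring

theorem exp_logVar_mul {f : unitInterval → ℂ} (hf : Continuous f) (h0 : ∀ t, f t ≠ 0) :
    Complex.exp (logVar f) * f 0 = f 1 := by
  obtain ⟨l, hl, h⟩ := exists_continuous_log_unitInterval f hf h0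
  rw [logVar_eq hl h, ← h 0, ← h 1, ← Complex.exp_add, sub_add_cancel]

theorem logVar_exp_mul {f f' g : unitInterval → ℂ} (hf : Continuous f) (h0 : ∀ t, f t ≠ 0)
    (hg : Continuous g) (h : ∀ t, f' t = Complex.exp (g t) * f t) :
    logVar f' = logVar f + (g 1 - g 0) := by
  obtain ⟨l, hl, hlf⟩ := exists_continuous_log_unitInterval f hf h0
  rw [logVar_eq hl hlf, logVar_eq (l := fun t ↦ g t + l t) (by fun_prop)
    (fun t ↦ by rw [Complex.exp_add, hlf, h])]
  ring

theorem logVar_neg {f : unitInterval → ℂ} (hf : Continuous f) (h0 : ∀ t, f t ≠ 0) :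
    logVar (fun t ↦ -f t) = logVar f := by
  rw [logVar_exp_mul hf h0 (g := fun _ ↦ Real.pi * Complex.I) continuous_const (by simp)]
  ring

theorem logVar_unitSquare {F : unitInterval → unitInterval → ℂ}
    (hF : Continuous (Function.uncurry F)) (h0 : ∀ s t, F s t ≠ 0) :
    logVar (fun s ↦ F s 0) + logVar (F 1) = logVar (F 0) + logVar (fun s ↦ F s 1) := by
  obtain ⟨l, hl, h⟩ := exists_continuous_log_unitSquare _ hF (fun x ↦ h0 x.1 x.2)
  have hl₁ (t) : logVar (fun s ↦ F s t) = l (1, t) - l (0, t) :=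
    logVar_eq (l := fun s ↦ l (s, t)) (by fun_prop) (fun s ↦ h (s, t))
  have hl₂ (s) : logVar (F s) = l (s, 1) - l (s, 0) :=
    logVar_eq (l := fun t ↦ l (s, t)) (by fun_prop) (fun t ↦ h (s, t))
  rw [hl₁, hl₁, hl₂, hl₂]
  ring

/-- For two disjoint paths `γ`, `δ`, the variation of the logarithm of `γ` seen from the ends of
`δ` differs by as much as the variation of the logarithm of `δ` seen from the ends of `γ`. -/
theorem logVar_sub_logVar_of_disjoint {u v u' v' : ℂ} (γ : Path u v) (δ : Path u' v')
    (h : ∀ s t, γ s ≠ δ t) :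
    logVar (fun t ↦ δ t - v) - logVar (fun t ↦ δ t - u) =
      logVar (fun t ↦ γ t - v') - logVar (fun t ↦ γ t - u') := by
  have hs := logVar_unitSquare (F := fun s t ↦ γ s - δ t)
    (by simp only [Function.uncurry_def]; fun_prop) (fun s t ↦ sub_ne_zero.2 (h s t))
  have e (w : unitInterval) : logVar (fun t ↦ γ w - δ t) = logVar (fun t ↦ δ t - γ w) := by
    rw [← logVar_neg (by fun_prop) (fun t ↦ sub_ne_zero.2 (h w t))]
    simp
  simp only [e] at hs
  simp only [Path.source, Path.target] at hs
  linear_combination hs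

/-- If `p` and `q` lie in a preconnected set disjoint from the closed set `K`, then
`(z - q) / (z - p)` has a continuous logarithm on `K`. -/
theorem exists_log_of_isPreconnected {K S : Set ℂ} (hK : IsClosed K) (hS : IsPreconnected S)
    (hSK : S ⊆ Kᶜ) {p q : ℂ} (hp : p ∈ S) (hq : q ∈ S) :
    ∃ g : ℂ → ℂ, ContinuousOn g K ∧ ∀ z ∈ K, z - q = Complex.exp (g z) * (z - p) := by
  refine hS.induction₂' (fun p q ↦ ∃ g : ℂ → ℂ, ContinuousOn g K ∧
    ∀ z ∈ K, z - q = Complex.exp (g z) * (z - p)) ?_ ?_ hp hq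
  · intro x hx
    obtain ⟨r, hr, hball⟩ := Metric.isOpen_iff.1 hK.isOpen_compl x (hSK hx)
    filter_upwards [mem_nhdsWithin_of_mem_nhds (Metric.ball_mem_nhds x hr)] with y hy
    have hx0 (z) (hz : z ∈ K) : z - x ≠ 0 := fun h ↦
      hball (Metric.mem_ball_self hr) (sub_eq_zero.1 h ▸ hz)
    have hy0 (z) (hz : z ∈ K) : z - y ≠ 0 := fun h ↦ hball hy (sub_eq_zero.1 h ▸ hz)
    have hslit (z) (hz : z ∈ K) : (z - y) / (z - x) ∈ Complex.slitPlane := by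
      have hzx : r ≤ ‖z - x‖ := by
        by_contra! hlt
        exact hball (by rwa [Metric.mem_ball, dist_eq_norm]) hz
      have hlt : ‖(z - y) / (z - x) - 1‖ < 1 := by
        rw [div_sub_one (hx0 z hz), norm_div, div_lt_one (by linarith)]
        rw [Metric.mem_ball, dist_comm, dist_eq_norm] at hy
        rw [show z - y - (z - x) = x - y by ring]
        linarith
      exact Complex.ball_one_subset_slitPlane (by rwa [Metric.mem_ball, dist_eq_norm])
    have hc : ContinuousOn (fun z ↦ Complex.log ((z - y) / (z - x))) K :=
      ContinuousOn.clog (ContinuousOn.div (by fun_prop) (by fun_prop) hx0) hslit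
    refine ⟨⟨_, hc, fun z hz ↦ ?_⟩, ⟨_, hc.neg, fun z hz ↦ ?_⟩⟩
    · rw [Complex.exp_log (div_ne_zero (hy0 z hz) (hx0 z hz)), div_mul_cancel₀ _ (hx0 z hz)]
    · simp only [Pi.neg_apply]
      rw [Complex.exp_neg, Complex.exp_log (div_ne_zero (hy0 z hz) (hx0 z hz)), inv_div,
        div_mul_cancel₀ _ (hy0 z hz)]
  · rintro x y z - - - ⟨g, hg, h⟩ ⟨g', hg', h'⟩
    refine ⟨fun w ↦ g' w + g w, hg'.add hg, fun w hw ↦ ?_⟩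
    rw [h' w hw, h w hw, Complex.exp_add, mul_assoc]

/-- A point off a planar theta graph with branch points `b 0`, `b 1` is separated from one of the
middle points `m k` by the cycle through the other two middle points. -/
theorem theta_separation {b : Fin 2 → ℂ} {m : Fin 3 → ℂ} {p : ℂ}
    (γ : ∀ s i, Path (b s) (m i))
    (hdisj : ∀ i j, i ≠ j → ∀ t t', γ 0 i t ≠ γ 1 j t')
    (hm : ∀ k s i, i ≠ k → ∀ t, γ s i t ≠ m k)
    (hp : ∀ s i t, γ s i t ≠ p) :
    ∃ k, ∀ S : Set ℂ, IsPreconnected S → p ∈ S → m k ∈ S →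
      ∃ s i, i ≠ k ∧ ∃ t, γ s i t ∈ S := by
  by_contra! hcon
  have hlog (k : Fin 3) : ∃ g : ℂ → ℂ, ∀ s i, i ≠ k →
      logVar (fun t ↦ γ s i t - m k) = logVar (fun t ↦ γ s i t - p) + (g (m i) - g (b s)) := by
    obtain ⟨S, hS, hpS, hmS, hdS⟩ := hcon k
    let K : Set ℂ := ⋃ s, ⋃ i ∈ {i | i ≠ k}, range (γ s i)
    have hK : IsClosed K := isClosed_iUnion_of_finite fun s ↦
      (toFinite _).isClosed_biUnion fun i _ ↦ (isCompact_range (γ s i).continuous).isClosed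
    have hmem (s i) (hi : i ≠ k) (t) : γ s i t ∈ K := by
      simp only [K, mem_iUnion]
      exact ⟨s, i, hi, t, rfl⟩
    have hSK : S ⊆ Kᶜ := by
      intro z hz hzK
      simp only [K, mem_iUnion] at hzK
      obtain ⟨s, i, hi, t, rfl⟩ := hzK
      exact hdS s i hi t hz
    obtain ⟨g, hg, h⟩ := exists_log_of_isPreconnected hK hS hSK hpS hmS
    refine ⟨g, fun s i hi ↦ ?_⟩
    rw [logVar_exp_mul (f := fun t ↦ γ s i t - p) (g := fun t ↦ g (γ s i t)) (by fun_prop)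
      (fun t ↦ sub_ne_zero.2 (hp s i t))
      (hg.comp_continuous (γ s i).continuous (hmem s i hi)) (fun t ↦ h _ (hmem s i hi t))]
    simp
  obtain ⟨g₀, h₀⟩ := hlog 0
  obtain ⟨g₁, h₁⟩ := hlog 1
  obtain ⟨g₂, h₂⟩ := hlog 2
  have hsq (i j) (hij : i ≠ j) := logVar_sub_logVar_of_disjoint (γ 0 i) (γ 1 j) (hdisj i j hij)
  have hexp (k i s) (hi : i ≠ k) :
      Complex.exp (logVar fun t ↦ γ s i t - m k) * (b s - m k) = m i - m k := by
    simpa using exp_logVar_mul (f := fun t ↦ γ s i t - m k) (by fun_prop)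
      (fun t ↦ sub_ne_zero.2 (hm k s i hi t))
  have hmm (i k) (hi : i ≠ k) : m i - m k ≠ 0 := by
    simpa [sub_ne_zero] using hm k 0 i hi 1
  have hbm (k) : b 0 - m k ≠ 0 := by
    obtain ⟨i, hi⟩ := exists_ne k
    simpa [sub_ne_zero] using hm k 0 i hi 0
  have hsum : (logVar fun t ↦ γ 0 1 t - m 0) - (logVar fun t ↦ γ 0 2 t - m 0) +
      ((logVar fun t ↦ γ 0 2 t - m 1) - (logVar fun t ↦ γ 0 0 t - m 1)) +
      ((logVar fun t ↦ γ 0 0 t - m 2) - (logVar fun t ↦ γ 0 1 t - m 2)) = 0 := by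
    linear_combination (1 / 2) * ((h₀ 0 1 (by decide)) - (h₀ 1 1 (by decide)) + (h₀ 1 2 (by decide)) - (h₀ 0 2 (by decide)) +
      (h₁ 0 2 (by decide)) - (h₁ 1 2 (by decide)) + (h₁ 1 0 (by decide)) - (h₁ 0 0 (by decide)) +
      (h₂ 0 0 (by decide)) - (h₂ 1 0 (by decide)) + (h₂ 1 1 (by decide)) - (h₂ 0 1 (by decide))) -
      (1 / 2) * ((hsq 1 0 (by decide)) - (hsq 0 1 (by decide)) + (hsq 0 2 (by decide)) -
      (hsq 2 0 (by decide)) + (hsq 2 1 (by decide)) - (hsq 1 2 (by decide)))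
  have hsub (k i j) (hi : i ≠ k) (hj : j ≠ k) :
      Complex.exp ((logVar fun t ↦ γ 0 i t - m k) - (logVar fun t ↦ γ 0 j t - m k)) =
        (m i - m k) / (m j - m k) := by
    rw [Complex.exp_sub, ← hexp k i 0 hi, ← hexp k j 0 hj, mul_div_mul_right _ _ (hbm k)]
  have hone := congr_arg Complex.exp hsum
  rw [Complex.exp_add, Complex.exp_add, hsub 0 1 2 (by decide) (by decide),
    hsub 1 2 0 (by decide) (by decide), hsub 2 0 1 (by decide) (by decide), Complex.exp_zero] at hone
  have e (i j) : m i - m j = -(m j - m i) := by ring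
  have h01 := hmm 1 0 (by decide)
  have h02 := hmm 2 0 (by decide)
  have h12 := hmm 2 1 (by decide)
  rw [e 0 1, e 0 2, e 1 2] at hone
  field_simp at hone
  norm_num at hone

theorem _root_.SimpleGraph.CliqueFree.not_adj_of_adj_of_adj {V : Type*} {Γ : SimpleGraph V}
    (hΓ : Γ.CliqueFree 3) {p q r : V} (hpq : Γ.Adj p q) (hpr : Γ.Adj p r) : ¬ Γ.Adj q r := by
  classical
  exact fun hqr ↦ hΓ {p, q, r} (SimpleGraph.is3Clique_triple_iff.2 ⟨hpq, hpr, hqr⟩)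

theorem isInducedFourCycle_of_adj {V : Type*} {Γ : SimpleGraph V} (hΓ : Γ.CliqueFree 3)
    {x y u v : V} (hxy : x ≠ y) (huv : u ≠ v) (hxu : Γ.Adj x u) (hxv : Γ.Adj x v)
    (hyu : Γ.Adj y u) (hyv : Γ.Adj y v) : IsInducedFourCycle Γ ![x, u, y, v] := by
  have hnxy : ¬ Γ.Adj x y := hΓ.not_adj_of_adj_of_adj hxu.symm hyu.symm
  have hnuv : ¬ Γ.Adj u v := hΓ.not_adj_of_adj_of_adj hxu hxv
  have := hxu.ne
  have := hxv.ne
  have := hyu.ne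
  have := hyv.ne
  refine ⟨fun i j h ↦ ?_, fun i j ↦ ?_⟩
  · fin_cases i <;> fin_cases j <;> simp_all [eq_comm]
  · fin_cases i <;> fin_cases j <;> simp_all [SimpleGraph.adj_comm]

theorem PlanarEmbedding.vmap_notMem_imageOf {V : Type*} {Γ : SimpleGraph V}
    (f : PlanarEmbedding Γ) {W : Set V} {v : V} (hv : v ∉ W) : f.vmap v ∉ f.imageOf W := by
  rintro (⟨w, hw, hwv⟩ | h)
  · exact hv (f.inj hwv ▸ hw)
  · simp only [mem_iUnion] at h
    obtain ⟨e, he, heW, hve⟩ := h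
    exact hv (heW v (f.vertexOnEdge e he v hve))

theorem PlanarEmbedding.vmap_mem_imageOf {V : Type*} {Γ : SimpleGraph V}
    (f : PlanarEmbedding Γ) {W : Set V} {v : V} (hv : v ∈ W) : f.vmap v ∈ f.imageOf W :=
  Or.inl (mem_image_of_mem _ hv)

theorem PlanarEmbedding.emap_subset_imageOf {V : Type*} {Γ : SimpleGraph V}
    (f : PlanarEmbedding Γ) {W : Set V} {u v : V} (h : Γ.Adj u v) (hu : u ∈ W) (hv : v ∈ W) :
    f.emap s(u, v) ⊆ f.imageOf W := by
  refine fun z hz ↦ Or.inr ?_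
  simp only [mem_iUnion]
  refine ⟨s(u, v), h, fun x hx ↦ ?_, hz⟩
  obtain rfl | rfl := Sym2.mem_iff.1 hx <;> assumption

theorem PlanarEmbedding.disjoint_emap {V : Type*} {Γ : SimpleGraph V} (f : PlanarEmbedding Γ)
    {e e' : Sym2 V} (he : e ∈ Γ.edgeSet) (he' : e' ∈ Γ.edgeSet) (h : ∀ v ∈ e, v ∉ e') :
    Disjoint (f.emap e) (f.emap e') := by
  rw [Set.disjoint_iff]
  rintro z ⟨hz, hz'⟩
  have hne : e ≠ e' := by
    rintro rfl
    induction e with | _ x y => exact h x (Sym2.mem_mk_left x y) (Sym2.mem_mk_left x y)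
  obtain ⟨v, rfl⟩ := f.disjointEdges e he e' he' hne ⟨hz, hz'⟩
  exact h v (f.vertexOnEdge e he v hz) (f.vertexOnEdge e' he' v hz')

/-- If an embedded suspension of three points misses a vertex of the graph, then one of its
4-cycles strongly separates the graph. -/
theorem exists_stronglySeparatesIn {V : Type*} {Γ : SimpleGraph V} (hΓ : Γ.CliqueFree 3)
    (f : PlanarEmbedding Γ) {a : Fin 3 → V} {b : Fin 2 → V} (ha : Function.Injective a)
    (hb : Function.Injective b) (hab : ∀ i j, a i ≠ b j) (hadj : ∀ i j, Γ.Adj (a i) (b j))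
    {v : V} (hva : ∀ i, v ≠ a i) (hvb : ∀ j, v ≠ b j) :
    ∃ c : Fin 4 → V, IsInducedFourCycle Γ c ∧ StronglySeparatesIn f c Set.univ := by
  choose γ hγ using fun (s : Fin 2) (i : Fin 3) ↦ f.arc (hadj i s).symm
  let e := Complex.equivRealProdCLM.symm
  have hmem (s i t) : γ s i t ∈ f.emap s(b s, a i) := (hγ s i).2 ▸ mem_range_self t
  have hedge (s i) : s(b s, a i) ∈ Γ.edgeSet := (hadj i s).symm
  have hvert (s i) (w : V) (hwb : w ≠ b s) (hwa : w ≠ a i) (t) : γ s i t ≠ f.vmap w := by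
    intro h
    obtain rfl | rfl := Sym2.mem_iff.1 (f.vertexOnEdge _ (hedge s i) w (h ▸ hmem s i t))
    exacts [hwb rfl, hwa rfl]
  obtain ⟨k, hk⟩ := theta_separation (b := fun s ↦ e (f.vmap (b s)))
    (m := fun i ↦ e (f.vmap (a i))) (p := e (f.vmap v)) (fun s i ↦ (γ s i).map e.continuous)
    (fun i j hij t t' h ↦ by
      have hd : Disjoint (f.emap s(b 0, a i)) (f.emap s(b 1, a j)) :=
        f.disjoint_emap (hedge 0 i) (hedge 1 j) (by
          simp [hb.eq_iff, ha.eq_iff, hij, hab, fun i j ↦ (hab i j).symm])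
      exact hd.ne_of_mem (hmem 0 i t) (hmem 1 j t') (e.injective h))
    (fun k s i hik t h ↦ hvert s i (a k) (hab k s) (ha.ne hik.symm) t (e.injective h))
    (fun s i t h ↦ hvert s i v (hvb s) (hva i) t (e.injective h))
  let c : Fin 4 → V := ![b 0, a (k + 1), b 1, a (k + 2)]
  have hk12 : k + 1 ≠ k + 2 ∧ k ≠ k + 1 ∧ k ≠ k + 2 := by clear hk; revert k; decide
  have hc : IsInducedFourCycle Γ c := isInducedFourCycle_of_adj hΓ (hb.ne (by decide))
    (ha.ne hk12.1) (hadj _ _).symm (hadj _ _).symm (hadj _ _).symm (hadj _ _).symm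
  have hrange : range c = {b 0, a (k + 1), b 1, a (k + 2)} := by
    ext w
    simp [c]
    tauto
  have hbc (s) : b s ∈ range c := by
    rw [hrange]; fin_cases s <;> simp
  have hac (i) (hi : i ≠ k) : a i ∈ range c := by
    have : i = k + 1 ∨ i = k + 2 :=
      (by decide : ∀ k i : Fin 3, i ≠ k → i = k + 1 ∨ i = k + 2) k i hi
    rw [hrange]; obtain rfl | rfl := this <;> simp
  have hv : v ∉ range c := by simp [hrange, hva, hvb]
  have hak : a k ∉ range c := by simp [hrange, hab, ha.eq_iff, hk12]
  refine ⟨c, hc, f.vmap v, f.vmap (a k), f.vmap_mem_imageOf (mem_univ _),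
    f.vmap_mem_imageOf (mem_univ _), f.vmap_notMem_imageOf hv, f.vmap_notMem_imageOf hak,
    fun hmem_comp ↦ ?_⟩
  obtain ⟨s, i, hik, t, z, hz, hzt⟩ := hk
    (e '' connectedComponentIn (f.imageOf (range c))ᶜ (f.vmap v))
    (isPreconnected_connectedComponentIn.image _ e.continuous.continuousOn)
    (mem_image_of_mem _ (mem_connectedComponentIn (f.vmap_notMem_imageOf hv)))
    (mem_image_of_mem _ hmem_comp)
  obtain rfl : z = γ s i t := e.injective hzt
  exact connectedComponentIn_subset _ _ hz
    (f.emap_subset_imageOf (hadj i s).symm (hbc s) (hac i hik) (hmem s i t))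

theorem IsPrime.isSuspensionOfThreePoints {V : Type*} {Γ : SimpleGraph V} (hΓ : Γ.CliqueFree 3)
    (hprime : IsPrime Γ) (h : ContainsSuspThree Γ) : IsSuspensionOfThreePoints Γ := by
  obtain ⟨-, f, hf⟩ := hprime
  obtain ⟨a, b, ha, hb, hab, hadj⟩ := h
  have hcover (v : V) : (∃ i, a i = v) ∨ ∃ j, b j = v := by
    by_contra! hv
    obtain ⟨c, hc, hs⟩ := exists_stronglySeparatesIn hΓ f ha hb hab hadj
      (fun i ↦ (hv.1 i).symm) (fun j ↦ (hv.2 j).symm)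
    exact hf c hc hs
  refine ⟨a, b, ha, hb, hab, eq_univ_of_forall hcover, fun x y ↦ ⟨fun hxy ↦ ?_, ?_⟩⟩
  · obtain ⟨i, rfl⟩ | ⟨i, rfl⟩ := hcover x <;> obtain ⟨j, rfl⟩ | ⟨j, rfl⟩ := hcover y
    · exact absurd hxy (hΓ.not_adj_of_adj_of_adj (hadj _ 0).symm (hadj _ _).symm)
    · exact Or.inl ⟨i, j, rfl, rfl⟩
    · exact Or.inr ⟨j, i, rfl, rfl⟩
    · exact absurd hxy (hΓ.not_adj_of_adj_of_adj (hadj 0 _) (hadj _ _))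
  · rintro (⟨i, j, rfl, rfl⟩ | ⟨i, j, rfl, rfl⟩)
    exacts [hadj i j, (hadj i j).symm]

theorem containsSuspThree_of_adj {V : Type*} {Γ : SimpleGraph V} {p q x y z : V} (hpq : p ≠ q)
    (hxy : x ≠ y) (hxz : x ≠ z) (hyz : y ≠ z) (hx : Γ.Adj x p ∧ Γ.Adj x q)
    (hy : Γ.Adj y p ∧ Γ.Adj y q) (hz : Γ.Adj z p ∧ Γ.Adj z q) : ContainsSuspThree Γ := by
  have hadj : ∀ i j, Γ.Adj (![x, y, z] i) (![p, q] j) := by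
    intro i j
    fin_cases i <;> fin_cases j <;> simp [hx, hy, hz]
  refine ⟨![x, y, z], ![p, q], fun i j h ↦ ?_, fun i j h ↦ ?_, fun i j ↦ (hadj i j).ne, hadj⟩
  · fin_cases i <;> fin_cases j <;> simp_all [eq_comm]
  · fin_cases i <;> fin_cases j <;> simp_all [eq_comm]

/-- An induced 4-cycle through the non-adjacent vertices `p`, `q` consists of `p`, `q` and two
common neighbours. -/
theorem IsFourCycleSet.exists_eq_insert {V : Type*} {Γ : SimpleGraph V} {s : Set V}
    (hs : IsFourCycleSet Γ s) {p q : V} (hp : p ∈ s) (hq : q ∈ s) (hpq : p ≠ q)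
    (hnadj : ¬ Γ.Adj p q) :
    ∃ x y, x ≠ y ∧ (Γ.Adj x p ∧ Γ.Adj x q) ∧ (Γ.Adj y p ∧ Γ.Adj y q) ∧ s = {p, q, x, y} := by
  obtain ⟨c, ⟨hinj, hc⟩, rfl⟩ := hs
  obtain ⟨i, rfl⟩ := hp
  obtain ⟨j, rfl⟩ := hq
  rw [hc] at hnadj
  have hj : j = i + 2 := by
    have := hinj.ne_iff.1 hpq
    clear hpq
    revert i j; decide
  subst hj
  refine ⟨c (i + 1), c (i + 3), hinj.ne (by clear hnadj hpq; revert i; decide), ?_, ?_, ?_⟩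
  · simp only [hc]; clear hnadj hpq; revert i; decide
  · simp only [hc]; clear hnadj hpq; revert i; decide
  · have : (univ : Set (Fin 4)) = {i, i + 2, i + 1, i + 3} := by
      ext j; simp; clear hnadj hpq; revert i j; decide
    rw [← image_univ, this]
    simp [image_insert_eq]

theorem containsSuspThree_of_fourCycleGraph_adj {V : Type*} {Γ : SimpleGraph V}
    {s t : {s : Set V // IsFourCycleSet Γ s}} (h : (fourCycleGraph Γ).Adj s t) :
    ContainsSuspThree Γ := by
  have key : ∀ s t : {s : Set V // IsFourCycleSet Γ s}, s ≠ t →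
      (∃ a b : V, a ≠ b ∧ ¬ Γ.Adj a b ∧ a ∈ s.1 ∩ t.1 ∧ b ∈ s.1 ∩ t.1) →
      ContainsSuspThree Γ := by
    rintro ⟨s, hs⟩ ⟨t, ht⟩ hst ⟨p, q, hpq, hnadj, ⟨hps, hpt⟩, hqs, hqt⟩
    obtain ⟨x, y, hxy, hx, hy, rfl⟩ := hs.exists_eq_insert hps hqs hpq hnadj
    obtain ⟨z, w, hzw, hz, hw, rfl⟩ := ht.exists_eq_insert hpt hqt hpq hnadj
    by_cases hzxy : z = x ∨ z = y
    · by_cases hwxy : w = x ∨ w = y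
      · refine absurd (Subtype.ext ?_) hst
        obtain rfl | rfl := hzxy <;> obtain rfl | rfl := hwxy
        · exact absurd rfl hzw
        · rfl
        · simp only [pair_comm]
        · exact absurd rfl hzw
      · push Not at hwxy
        exact containsSuspThree_of_adj hpq hxy hwxy.1.symm hwxy.2.symm hx hy hw
    · push Not at hzxy
      exact containsSuspThree_of_adj hpq hxy hzxy.1.symm hzxy.2.symm hx hy hz
  obtain ⟨hne, h | h⟩ := (SimpleGraph.fromRel_adj _ _ _).1 h
  exacts [key s t hne h, key t s hne.symm h]

theorem CFS.containsSuspThree {V : Type*} {Γ : SimpleGraph V} (hΓ : Γ.CliqueFree 3)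
    (hcard : 5 ≤ Nat.card V) (h : CFS Γ) : ContainsSuspThree Γ := by
  obtain ⟨Ω, K, hcover, -, -, -, hjoin, s₀, hs₀⟩ := h
  obtain ⟨c, hc, hcs⟩ := s₀.2
  have hΩ (v : V) : v ∈ Ω := by
    by_contra hv
    have hvK : v ∈ K := (hcover.ge (mem_univ v)).resolve_left hv
    exact hΓ.not_adj_of_adj_of_adj (hjoin _ (c 0).2 v hvK).symm (hjoin _ (c 1).2 v hvK).symm
      ((hc.2 0 1).2 (Or.inl rfl) : (Γ.induce Ω).Adj (c 0) (c 1))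
  obtain ⟨v, hv⟩ : ∃ v : V, ∀ i, (c i).1 ≠ v := by
    by_contra! hsurj
    have := Nat.card_le_card_of_surjective (fun i ↦ (c i).1) hsurj
    simp at this
    omega
  obtain ⟨t, hreach, hvt⟩ := hs₀ ⟨v, hΩ v⟩
  have hne : s₀ ≠ t := by
    rintro rfl
    rw [← hcs] at hvt
    obtain ⟨i, hi⟩ := hvt
    exact hv i (congr_arg Subtype.val hi)
  obtain ⟨w⟩ := hreach
  obtain ⟨a, b, ha, hb, hab, hadj⟩ : ContainsSuspThree (Γ.induce Ω) := by
    cases w with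
    | nil => exact absurd rfl hne
    | cons h _ => exact containsSuspThree_of_fourCycleGraph_adj h
  exact ⟨fun i ↦ (a i).1, fun j ↦ (b j).1, Subtype.val_injective.comp ha,
    Subtype.val_injective.comp hb, fun i j ↦ Subtype.coe_injective.ne (hab i j), hadj⟩

/-- Lemma `le0`: a prime graph satisfying the Standing Assumptions is either
the suspension of three distinct points or contains no suspension of three distinct points;
in particular, a prime CFS graph satisfying the Standing Assumptions is the suspension of
exactly three points. -/
theorem stmt_8 {V : Type} (Γ : SimpleGraph V) (hSA : StandingAssumptions Γ)
    (hprime : IsPrime Γ) :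
    (IsSuspensionOfThreePoints Γ ∨ ¬ ContainsSuspThree Γ) ∧
    (CFS Γ → IsSuspensionOfThreePoints Γ) := by
  obtain ⟨-, hΓ, -, hcard, -, -⟩ := hSA
  refine ⟨or_iff_not_imp_right.2 fun h ↦ ?_, fun h ↦ ?_⟩
  · exact hprime.isSuspensionOfThreePoints hΓ (not_not.1 h)
  · exact hprime.isSuspensionOfThreePoints hΓ (h.containsSuspThree hΓ hcard)

end Paper
end
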